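/- Let X be a finite poset and Y ⊆ X a subposet. Then the geometric realization |K(X − Y)| of the order complex of the complement is a strong deformation retract of |K(X)| − |K(Y)| (the realization of the order complex of X with the closed subcomplex realized by chains in Y removed). -/

import Mathlib

/-- The geometric realization of the order complex `K(X)` of a finite poset `X`:
formal convex combinations supported on a chain of `X`. -/
def geomReal (X : Type*) [PartialOrder X] [Fintype X] : Set (X → ℝ) :=
  {w | (∀ x, 0 ≤ w x) ∧ (∑ x, w x) = 1 ∧ IsChain (· ≤ ·) {x | w x ≠ 0}}

/-- The realization `|K(X)| − |K(Y)|`: points of the order complex of `X` whose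
support is not contained in the subposet `Y`. -/
def KminusKY (X : Type*) [PartialOrder X] [Fintype X] (Y : Set X) : Set (X → ℝ) :=
  {w | w ∈ geomReal X ∧ ¬ ({x | w x ≠ 0} ⊆ Y)}

/-- The realization `|K(X − Y)|`: points of the order complex of `X` supported in
the complement of `Y`. -/
def KcomplY (X : Type*) [PartialOrder X] [Fintype X] (Y : Set X) : Set (X → ℝ) :=
  {w | w ∈ geomReal X ∧ ∀ x ∈ Y, w x = 0}

/-- For a finite poset `X` and a subposet `Y ⊆ X`, the realization
`|K(X − Y)|` is a strong deformation retract of `|K(X)| − |K(Y)|`: there is a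
homotopy `H` on `|K(X)| − |K(Y)|` starting at the identity, ending in `|K(X − Y)|`,
and fixing `|K(X − Y)|` pointwise throughout. -/
theorem order_complex_complement_strong_deformation_retract
    (X : Type*) [PartialOrder X] [Fintype X] (Y : Set X) :
    ∃ H : C(↥(KminusKY X Y) × unitInterval, ↥(KminusKY X Y)),
      (∀ a, H (a, 0) = a) ∧
      (∀ a, ((H (a, 1) : X → ℝ)) ∈ KcomplY X Y) ∧
      (∀ (a : ↥(KminusKY X Y)), (a : X → ℝ) ∈ KcomplY X Y → ∀ t, H (a, t) = a) := by
  classical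
  let S : (X → ℝ) → ℝ := fun w => ∑ x, if x ∈ Y then 0 else w x
  have hS : ∀ w ∈ KminusKY X Y, 0 < S w := by
    rintro w ⟨⟨h0, -, -⟩, hn⟩
    obtain ⟨x, hx, hxY⟩ := Set.not_subset.1 hn
    refine Finset.sum_pos' (fun y _ => ?_) ⟨x, Finset.mem_univ x, ?_⟩
    · split_ifs
      · exact le_rfl
      · exact h0 y
    · rw [if_neg hxY]
      exact lt_of_le_of_ne (h0 x) (Ne.symm hx)
  have hScont : Continuous S := by
    refine continuous_finset_sum _ (fun x _ => ?_)
    split_ifs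
    · exact continuous_const
    · exact continuous_apply x
  let G : (X → ℝ) → ℝ → X → ℝ := fun w t x =>
    (1 - t) * w x + t * ((if x ∈ Y then 0 else w x) / S w)
  have hG0 : ∀ w x, w x = 0 → ∀ t, G w t x = 0 := by
    intro w x h t
    simp [G, h]
  have hGgeom : ∀ w ∈ KminusKY X Y, ∀ t ∈ unitInterval, G w t ∈ geomReal X := by
    intro w hw t ht
    have hp := hS w hw
    obtain ⟨⟨h0, h1, hc⟩, hn⟩ := hw
    refine ⟨fun x => ?_, ?_, ?_⟩
    · have h2 : 0 ≤ (if x ∈ Y then 0 else w x) := by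
        split_ifs
        · exact le_rfl
        · exact h0 x
      exact add_nonneg (mul_nonneg (sub_nonneg.2 ht.2) (h0 x))
        (mul_nonneg ht.1 (div_nonneg h2 hp.le))
    · have h3 : (∑ x, (if x ∈ Y then 0 else w x) / S w) = 1 := by
        rw [← Finset.sum_div]
        exact div_self hp.ne'
      simp only [G]
      rw [Finset.sum_add_distrib, ← Finset.mul_sum, ← Finset.mul_sum, h1, h3]
      ring
    · exact hc.mono (fun x hx hw0 => hx (hG0 w x hw0 t))
  have hGmem : ∀ w ∈ KminusKY X Y, ∀ t ∈ unitInterval, G w t ∈ KminusKY X Y := by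
    intro w hw t ht
    refine ⟨hGgeom w hw t ht, ?_⟩
    have hp := hS w hw
    obtain ⟨⟨h0, h1, hc⟩, hn⟩ := hw
    obtain ⟨x, hx, hxY⟩ := Set.not_subset.1 hn
    have hx0 : 0 < w x := lt_of_le_of_ne (h0 x) (Ne.symm hx)
    intro hsub
    refine hxY (hsub ?_)
    have hd : 0 < w x / S w := div_pos hx0 hp
    have hpos : 0 < G w t x := by
      simp only [G, if_neg hxY]
      rcases ht.1.eq_or_lt with h | h
      · rw [← h]
        simpa using hx0
      · exact add_pos_of_nonneg_of_pos (mul_nonneg (sub_nonneg.2 ht.2) hx0.le) (mul_pos h hd)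
    exact hpos.ne'
  refine ⟨⟨fun p => ⟨G p.1.1 p.2.1, hGmem _ p.1.2 _ p.2.2⟩, ?_⟩, ?_, ?_, ?_⟩
  · refine Continuous.subtype_mk (continuous_pi fun x => ?_) _
    have hw : Continuous fun p : ↥(KminusKY X Y) × unitInterval => p.1.1 x :=
      (continuous_apply x).comp (continuous_subtype_val.comp continuous_fst)
    have ht : Continuous fun p : ↥(KminusKY X Y) × unitInterval => (p.2.1 : ℝ) :=
      continuous_subtype_val.comp continuous_snd
    have hs : Continuous fun p : ↥(KminusKY X Y) × unitInterval => S p.1.1 :=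
      hScont.comp (continuous_subtype_val.comp continuous_fst)
    refine ((continuous_const.sub ht).mul hw).add (ht.mul (Continuous.div ?_ hs ?_))
    · split_ifs
      · exact continuous_const
      · exact hw
    · exact fun p => (hS _ p.1.2).ne'
  · intro a
    apply Subtype.ext
    funext x
    simp [G]
  · intro a
    refine ⟨hGgeom _ a.2 _ (1 : unitInterval).2, fun x hx => ?_⟩
    simp [G, hx]
  · intro a ha t
    apply Subtype.ext
    funext x
    have he : ∀ x, (if x ∈ Y then 0 else a.1 x) = a.1 x := by
      intro x
      split_ifs with h
      · exact (ha.2 x h).symm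
      · rfl
    have hs1 : S a.1 = 1 := by
      simp only [S, he]
      exact ha.1.2.1
    change (1 - (t : ℝ)) * a.1 x + t * ((if x ∈ Y then 0 else a.1 x) / S a.1) = a.1 x
    rw [he, hs1]
    ring
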